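/- Let V and W be filtered directed systems over ℝ₊ such that A = colim V carries a K-algebra multiplication ⋆ and M = colim W carries the structure of a module over (A,⋆) with scalar multiplication ∗. Assume the spectral number c_V is subadditive with respect to ⋆, the spectral number c_W is subadditive with respect to ∗, and M ≠ 0 is a stretched module over A. Then Γ̃(W) ≥ Γ̃(V); moreover, for every finite subset S ⊆ A with ρ(S) = max_{x∈S} c_V(x) > 0 one has Γ̃(W) ≥ Γ^alg_S(A) / ρ(S). -/

import Mathlib

open scoped NNReal

/-- A filtered directed system of finite-dimensional `K`-vector spaces over `ℝ₊ = [0,∞)`. -/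
structure FDS (K : Type) [Field K] where
  V : ℝ≥0 → Type
  [acg : ∀ t, AddCommGroup (V t)]
  [mod : ∀ t, Module K (V t)]
  [fd : ∀ t, FiniteDimensional K (V t)]
  map : ∀ {s t : ℝ≥0}, s ≤ t → V s →ₗ[K] V t
  map_self : ∀ (t : ℝ≥0) (x : V t), map (le_refl t) x = x
  map_map : ∀ {r s t : ℝ≥0} (h1 : r ≤ s) (h2 : s ≤ t) (x : V r),
      map h2 (map h1 x) = map (h1.trans h2) x

attribute [instance] FDS.acg FDS.mod FDS.fd

/-- The direct limit (colimit) of a filtered directed system, presented as a cocone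
`ι t : V t → A` which is jointly surjective and exact (the standard description of the
direct limit over the directed set `[0,∞)`). -/
structure FDSColimit (K : Type) [Field K] (V : FDS K) where
  A : Type
  [acg : AddCommGroup A]
  [mod : Module K A]
  ι : ∀ t : ℝ≥0, V.V t →ₗ[K] A
  ι_map : ∀ {s t : ℝ≥0} (h : s ≤ t) (x : V.V s), ι t (V.map h x) = ι s x
  surj : ∀ a : A, ∃ t x, ι t x = a
  exct : ∀ (t : ℝ≥0) (x : V.V t), ι t x = 0 → ∃ s, ∃ h : t ≤ s, V.map h x = 0

attribute [instance] FDSColimit.acg FDSColimit.mod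

/-- The spectral number `c(x) = inf {t | x ∈ range (ι t)}`. -/
noncomputable def FDSColimit.spec {K : Type} [Field K] {V : FDS K}
    (C : FDSColimit K V) (x : C.A) : ℝ≥0 :=
  sInf {t : ℝ≥0 | x ∈ LinearMap.range (C.ι t)}


/-- The exponential growth rate `Γ̃(V) = limsup_{t→∞} log(d_t)/t` of a filtered directed
system, where `d_t = dim_K {x ∈ colim V | c(x) ≤ t}` (with the convention `log 0 = 0`,
which is `Real.log`'s convention), taken in the extended reals. -/
noncomputable def FDSColimit.growth {K : Type} [Field K] {V : FDS K}
    (C : FDSColimit K V) : EReal :=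
  Filter.limsup (fun t : ℝ≥0 =>
    ((Real.log (Module.finrank K (Submodule.span K {x : C.A | C.spec x ≤ t})) / (t : ℝ) : ℝ) :
      EReal)) Filter.atTop

/-- For a (not necessarily unital) `K`-algebra structure given by a `K`-bilinear
multiplication `mul` on `A` and a subset `S ⊆ A`, `WSpan mul S n` is the `K`-linear span of
the set `⋃_{j=1}^n N_S(j)` of all products of at most `n` (and at least one) elements of `S`. -/
def WSpan {K : Type} [Field K] {A : Type} [AddCommGroup A] [Module K A]
    (mul : A →ₗ[K] A →ₗ[K] A) (S : Set A) (n : ℕ) : Submodule K A :=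
  Submodule.span K {a : A | ∃ (h : A) (l : List A), h ∈ S ∧ (∀ x ∈ l, x ∈ S) ∧
    l.length + 1 ≤ n ∧ a = l.foldl (fun x y => mul x y) h}

/-- The exponential algebraic growth rate
`Γ^alg_S(A) = limsup_{n→∞} (1/n) log dim_K W_S(n)` (with the convention `log 0 = 0`,
which is `Real.log`'s convention). -/
noncomputable def algGrowth {K : Type} [Field K] {A : Type} [AddCommGroup A] [Module K A]
    (mul : A →ₗ[K] A →ₗ[K] A) (S : Set A) : ℝ :=
  Filter.limsup
    (fun n : ℕ => Real.log (Module.finrank K (WSpan mul S n)) / (n : ℝ)) Filter.atTop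

theorem log_natCast_mono : Monotone fun n : ℕ => Real.log (n : ℝ) := by
  intro a b h
  rcases Nat.eq_zero_or_pos a with rfl | ha
  · simpa using Real.log_natCast_nonneg b
  · exact Real.log_le_log (by exact_mod_cast ha) (by exact_mod_cast h)

namespace FDSColimit

variable {K : Type} [Field K] {V W : FDS K}

/-- The span of the elements of spectral number at most `t`. -/
def sublevel (C : FDSColimit K V) (t : ℝ≥0) : Submodule K C.A :=
  Submodule.span K {x : C.A | C.spec x ≤ t}

theorem range_mono (C : FDSColimit K V) {s t : ℝ≥0} (h : s ≤ t) :
    LinearMap.range (C.ι s) ≤ LinearMap.range (C.ι t) := by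
  rintro _ ⟨x, rfl⟩
  exact ⟨V.map h x, C.ι_map h x⟩

theorem mem_range_of_spec_lt (C : FDSColimit K V) {x : C.A} {t : ℝ≥0} (h : C.spec x < t) :
    x ∈ LinearMap.range (C.ι t) := by
  obtain ⟨s₀, y, hy⟩ := C.surj x
  obtain ⟨s, hs, hst⟩ :=
    exists_lt_of_csInf_lt (s := {t : ℝ≥0 | x ∈ LinearMap.range (C.ι t)}) ⟨s₀, y, hy⟩ h
  exact C.range_mono hst.le hs

instance finiteDimensional_sublevel (C : FDSColimit K V) (t : ℝ≥0) :
    FiniteDimensional K (C.sublevel t) := by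
  have h : C.sublevel t ≤ LinearMap.range (C.ι (t + 1)) :=
    Submodule.span_le.2 fun x hx =>
      C.mem_range_of_spec_lt (lt_of_le_of_lt hx (lt_add_of_pos_right t one_pos))
  exact Submodule.finiteDimensional_of_le h

theorem growth_eq (C : FDSColimit K V) :
    C.growth = Filter.limsup (fun t : ℝ≥0 =>
      ((Real.log (Module.finrank K (C.sublevel t)) / (t : ℝ) : ℝ) : EReal)) Filter.atTop :=
  rfl

/-- A shift of the filtration level does not affect exponential upper bounds above the
growth rate. -/
theorem eventually_log_finrank_le (C : FDSColimit K V) {α : Type} {l : Filter α}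
    {τ : α → ℝ≥0} (hτ : Filter.Tendsto τ l Filter.atTop) (c : ℝ≥0) {r : ℝ}
    (hr : C.growth < r) :
    ∀ᶠ i in l, Real.log (Module.finrank K (C.sublevel (τ i + c))) ≤ r * τ i := by
  obtain ⟨q, hq, hqr⟩ := EReal.lt_iff_exists_real_btwn.1 hr
  have hqr' : q < r := by exact_mod_cast hqr
  rw [growth_eq] at hq
  have hshift : Filter.Tendsto (fun i => τ i + c) l Filter.atTop :=
    Filter.tendsto_atTop_mono (fun i => le_self_add) hτ
  have hlim := hshift.eventually (Filter.eventually_lt_of_limsup_lt hq)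
  have hτ' : Filter.Tendsto (fun i => (τ i : ℝ)) l Filter.atTop :=
    NNReal.tendsto_coe_atTop.2 hτ
  filter_upwards [hlim, hτ'.eventually_ge_atTop (q * c / (r - q)),
    hτ'.eventually_gt_atTop 0] with i h₁ h₂ h₃
  have h₁' := EReal.coe_lt_coe_iff.1 h₁
  have hpos : (0 : ℝ) < (τ i + c : ℝ≥0) := by
    rw [NNReal.coe_add]
    exact add_pos_of_pos_of_nonneg h₃ c.2
  rw [div_lt_iff₀ hpos, NNReal.coe_add] at h₁'
  rw [div_le_iff₀ (sub_pos.2 hqr')] at h₂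
  linarith

theorem finrank_sublevel_le_of_injective (CV : FDSColimit K V) (CW : FDSColimit K W)
    (f : CV.A →ₗ[K] CW.A) (hf : Function.Injective f) (c : ℝ≥0)
    (hc : ∀ a, CW.spec (f a) ≤ CV.spec a + c) (t : ℝ≥0) :
    Module.finrank K (CV.sublevel t) ≤ Module.finrank K (CW.sublevel (t + c)) := by
  rw [(Submodule.equivMapOfInjective f hf (CV.sublevel t)).finrank_eq]
  refine Submodule.finrank_mono ?_
  rw [sublevel, Submodule.map_span, Submodule.span_le]
  rintro _ ⟨a, ha, rfl⟩
  exact Submodule.subset_span ((hc a).trans (add_le_add_left ha c))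

theorem spec_foldl_le (C : FDSColimit K V) (mul : C.A →ₗ[K] C.A →ₗ[K] C.A)
    (hmul : ∀ a b : C.A, C.spec (mul a b) ≤ C.spec a + C.spec b) {ρ : ℝ≥0} (l : List C.A)
    (hl : ∀ x ∈ l, C.spec x ≤ ρ) (h : C.A) :
    C.spec (l.foldl (fun x y => mul x y) h) ≤ C.spec h + l.length * ρ := by
  induction l generalizing h with
  | nil => simp
  | cons x l ih =>
    refine (ih (fun y hy => hl y (List.mem_cons_of_mem x hy)) (mul h x)).trans ?_
    calc C.spec (mul h x) + l.length * ρ ≤ (C.spec h + ρ) + l.length * ρ := by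
          gcongr
          exact (hmul h x).trans (by gcongr; exact hl x List.mem_cons_self)
      _ = C.spec h + (x :: l).length * ρ := by
          rw [List.length_cons]
          push_cast
          ring

theorem WSpan_le_sublevel (C : FDSColimit K V) (mul : C.A →ₗ[K] C.A →ₗ[K] C.A)
    (hmul : ∀ a b : C.A, C.spec (mul a b) ≤ C.spec a + C.spec b) {S : Set C.A} {ρ : ℝ≥0}
    (hS : ∀ x ∈ S, C.spec x ≤ ρ) (n : ℕ) : WSpan mul S n ≤ C.sublevel (n * ρ) := by
  refine Submodule.span_le.2 ?_
  rintro _ ⟨h, l, hh, hl, hn, rfl⟩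
  refine Submodule.subset_span ?_
  have hn' : ((l.length + 1 : ℕ) : ℝ≥0) ≤ n := by exact_mod_cast hn
  calc C.spec (l.foldl (fun x y => mul x y) h) ≤ C.spec h + l.length * ρ :=
        C.spec_foldl_le mul hmul l (fun x hx => hS x (hl x hx)) h
    _ ≤ ρ + l.length * ρ := by gcongr; exact hS h hh
    _ = ((l.length + 1 : ℕ) : ℝ≥0) * ρ := by push_cast; ring
    _ ≤ n * ρ := by gcongr

end FDSColimit

/-- Let `A = colim V` carry a `K`-algebra multiplication `⋆` and `M = colim W` the structure
of a module over `(A,⋆)` with scalar multiplication `∗`. If the spectral numbers are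
subadditive with respect to `⋆` and `∗`, and `M ≠ 0` is a stretched module over `A`, then
`Γ̃(W) ≥ Γ̃(V)`, and moreover `Γ̃(W) ≥ Γ^alg_S(A)/ρ(S)` for every finite `S ⊆ A` with
`ρ(S) = max_{x ∈ S} c_V(x) > 0`. -/
theorem growth_module_stretched {K : Type} [Field K] {V W : FDS K}
    (CV : FDSColimit K V) (CW : FDSColimit K W)
    (mul : CV.A →ₗ[K] CV.A →ₗ[K] CV.A)
    (mul_assoc : ∀ a b c : CV.A, mul (mul a b) c = mul a (mul b c))
    (smul : CV.A →ₗ[K] CW.A →ₗ[K] CW.A)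
    (smul_mul : ∀ (a b : CV.A) (m : CW.A), smul (mul a b) m = smul a (smul b m))
    (subadd_mul : ∀ a b : CV.A, CV.spec (mul a b) ≤ CV.spec a + CV.spec b)
    (subadd_smul : ∀ (a : CV.A) (m : CW.A), CW.spec (smul a m) ≤ CV.spec a + CW.spec m)
    (hM : ∃ m : CW.A, m ≠ 0)
    (stretched : ∃ m₀ : CW.A, ∀ a : CV.A, a ≠ 0 → smul a m₀ ≠ 0) :
    CV.growth ≤ CW.growth ∧
      ∀ (S : Finset CV.A) (hS : S.Nonempty),
        0 < (S.sup' hS fun x => CV.spec x) →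
        ((algGrowth mul (↑S) / ((S.sup' hS fun x => CV.spec x : ℝ≥0) : ℝ) : ℝ) : EReal) ≤
          CW.growth := by
  obtain ⟨m₀, hm₀⟩ := stretched
  have hinj : Function.Injective (smul.flip m₀) :=
    (injective_iff_map_eq_zero _).2 fun a ha => by_contra fun h => hm₀ a h ha
  have hlog (t : ℝ≥0) : Real.log (Module.finrank K (CV.sublevel t)) ≤
      Real.log (Module.finrank K (CW.sublevel (t + CW.spec m₀))) :=
    log_natCast_mono (CV.finrank_sublevel_le_of_injective CW _ hinj _
      (fun a => subadd_smul a m₀) t)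
  refine ⟨EReal.le_of_forall_lt_iff_le.1 fun r hr => ?_, fun S hS hρ =>
    EReal.le_of_forall_lt_iff_le.1 fun r hr => ?_⟩
  · rw [CV.growth_eq]
    refine Filter.limsup_le_of_le (h := ?_)
    filter_upwards [CW.eventually_log_finrank_le Filter.tendsto_id (CW.spec m₀) hr,
      Filter.eventually_gt_atTop 0] with t ht hpos
    exact EReal.coe_le_coe_iff.2
      ((div_le_iff₀ (NNReal.coe_pos.2 hpos)).2 ((hlog t).trans ht))
  · set ρ : ℝ≥0 := S.sup' hS fun x => CV.spec x
    have hτ : Filter.Tendsto (fun n : ℕ => (n : ℝ≥0) * ρ) Filter.atTop Filter.atTop :=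
      tendsto_natCast_atTop_atTop.atTop_mul_const hρ
    rw [EReal.coe_le_coe_iff, div_le_iff₀ (NNReal.coe_pos.2 hρ)]
    refine Filter.limsup_le_of_le
      (Filter.isCoboundedUnder_le_of_le Filter.atTop (x := 0) fun n => by positivity) ?_
    filter_upwards [CW.eventually_log_finrank_le hτ (CW.spec m₀) hr,
      Filter.eventually_gt_atTop 0] with n hn hpos
    have hW : Real.log (Module.finrank K (WSpan mul (S : Set CV.A) n)) ≤
        Real.log (Module.finrank K (CV.sublevel (n * ρ))) :=
      log_natCast_mono (Submodule.finrank_mono (CV.WSpan_le_sublevel mul subadd_mul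
        (fun x hx => Finset.le_sup' (fun x => CV.spec x) hx) n))
    rw [div_le_iff₀ (by exact_mod_cast hpos)]
    refine (hW.trans ((hlog _).trans hn)).trans_eq ?_
    push_cast
    ring
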